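/- arXiv:2504.11646 — 3 statements merged into one kernel-verified Lean document; each statement's English description precedes it below -/
import Mathlib

section
/- The unit sphere {h ∈ H : ‖h‖ = 1} of H is contractible. -/
open Metric in
/-- Normalised straight-line homotopy on the sphere. -/
theorem sphere_homotopic_aux {H : Type*} [NormedAddCommGroup H] [InnerProductSpace ℂ H]
    (f g : C(sphere (0 : H) 1, sphere (0 : H) 1))
    (h : ∀ x, (f x : H) + (g x : H) ≠ 0) : f.Homotopic g := by
  have key : ∀ (t : unitInterval) (x : sphere (0 : H) 1),
      ((1 - (t : ℝ)) • (f x : H) + (t : ℝ) • (g x : H)) ≠ 0 := by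
    intro t x h0
    have h1 : (1 - (t : ℝ)) • (f x : H) = - ((t : ℝ) • (g x : H)) := eq_neg_of_add_eq_zero_left h0
    have h2 := congrArg norm h1
    have hf : ‖(f x : H)‖ = 1 := by simpa using (f x).2
    have hg : ‖(g x : H)‖ = 1 := by simpa using (g x).2
    have ht0 := t.2.1
    have ht1 := t.2.2
    rw [norm_neg, norm_smul, norm_smul, hf, hg, Real.norm_of_nonneg (by linarith),
      Real.norm_of_nonneg ht0] at h2
    have h3 : (t : ℝ) = 1 / 2 := by linarith
    apply h x
    rw [h3] at h0
    norm_num at h0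
    rw [← smul_add] at h0
    exact (smul_eq_zero.1 h0).resolve_left (by norm_num)
  refine ⟨⟨⟨fun p => ⟨(‖(1 - (p.1 : ℝ)) • (f p.2 : H) + (p.1 : ℝ) • (g p.2 : H)‖⁻¹ : ℝ) •
      ((1 - (p.1 : ℝ)) • (f p.2 : H) + (p.1 : ℝ) • (g p.2 : H)), ?_⟩, ?_⟩, ?_, ?_⟩⟩
  · rw [mem_sphere_zero_iff_norm, norm_smul, norm_inv, norm_norm]
    exact inv_mul_cancel₀ (norm_ne_zero_iff.2 (key _ _))
  · refine Continuous.subtype_mk ?_ _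
    have hc : Continuous fun p : unitInterval × sphere (0 : H) 1 =>
        ((1 - (p.1 : ℝ)) • (f p.2 : H) + (p.1 : ℝ) • (g p.2 : H)) := by fun_prop
    exact (hc.norm.inv₀ fun p => norm_ne_zero_iff.2 (key _ _)).smul hc
  · intro x
    ext
    simp
  · intro x
    ext
    simp

/-- An isometry shifting an orthonormal family. -/
theorem exists_shift_aux {H : Type*} [NormedAddCommGroup H] [InnerProductSpace ℂ H]
    [CompleteSpace H] {ι : Type*} (b : HilbertBasis ι ℂ H) (σ : ι → ι)
    (hσ : Function.Injective σ) :
    ∃ S : H →ₗᵢ[ℂ] H, (∀ x i, inner ℂ (b (σ i)) (S x) = inner ℂ (b i) x) ∧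
      ∀ x j, (∀ i, σ i ≠ j) → inner ℂ (b j) (S x) = 0 := by
  have ho : Orthonormal ℂ (b ∘ σ) := b.orthonormal.comp σ hσ
  have hsum := fun x => (ho.orthogonalFamily).hasSum_linearIsometry (b.repr x)
  refine ⟨(ho.orthogonalFamily).linearIsometry.comp b.repr.toLinearIsometry, ?_, ?_⟩
  · intro x i
    have h := (hsum x).mapL (innerSL ℂ (b (σ i)))
    have h2 := hasSum_single (f := fun k => innerSL ℂ (b (σ i))
      ((LinearIsometry.toSpanSingleton ℂ H (ho.1 k)) (b.repr x k))) i (by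
        intro k hk
        have : inner ℂ (b (σ i)) (b (σ k)) = 0 := ho.2 (Ne.symm hk)
        simp [inner_smul_right, this])
    have h3 := h.unique h2
    simpa [inner_smul_right, b.orthonormal.1 (σ i), b.repr_apply_apply] using h3
  · intro x j hj
    have h := (hsum x).mapL (innerSL ℂ (b j))
    have h2 : HasSum (fun k => innerSL ℂ (b j)
      ((LinearIsometry.toSpanSingleton ℂ H (ho.1 k)) (b.repr x k))) 0 := by
      convert hasSum_zero with k
      have : inner ℂ (b j) (b (σ k)) = 0 := b.orthonormal.2 (hj k).symm
      simp [inner_smul_right, this]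
    simpa using h.unique h2

/-- Theorem (Kakutani): the unit sphere of a separable infinite-dimensional complex
Hilbert space is contractible. -/
theorem stmt2 {H : Type*} [NormedAddCommGroup H] [InnerProductSpace ℂ H]
    [CompleteSpace H] [TopologicalSpace.SeparableSpace H]
    (hinf : ¬FiniteDimensional ℂ H) :
    ContractibleSpace (Metric.sphere (0 : H) 1) := by
  obtain ⟨w, b, -⟩ := exists_hilbertBasis ℂ H
  have hw : Infinite w := by
    by_contra hfin
    rw [not_infinite_iff_finite] at hfin
    have := Fintype.ofFinite w
    exact hinf b.toOrthonormalBasis.toBasis.finiteDimensional_of_finite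
  obtain ⟨φ⟩ : Nonempty (w ≃ w × ℕ) := by
    rw [← Cardinal.lift_mk_eq']
    simp
  let σ : w → w := fun i => φ.symm ((φ i).1, (φ i).2 + 1)
  have hσ : Function.Injective σ := by
    intro i j hij
    have := φ.symm.injective hij
    simp only [Prod.mk.injEq, add_left_inj] at this
    exact φ.injective (Prod.ext this.1 this.2)
  have hσ0 : ∀ k i, σ i ≠ φ.symm (k, 0) := by
    intro k i hi
    have := φ.symm.injective hi
    simp at this
  obtain ⟨S, hS, hS0⟩ := exists_shift_aux b σ hσ
  have hnoeig : ∀ x, x + S x = 0 → x = 0 := by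
    intro x hx
    have hx' : S x = -x := eq_neg_of_add_eq_zero_right hx
    have hz : ∀ n k, inner ℂ (b (φ.symm (k, n))) x = 0 := by
      intro n
      induction n with
      | zero =>
        intro k
        have := hS0 x _ (hσ0 k)
        simpa [hx'] using this
      | succ n ih =>
        intro k
        have := hS x (φ.symm (k, n))
        simpa [hx', σ, ih k] using this
    have hr : b.repr x = 0 := by
      ext i
      rw [b.repr_apply_apply]
      simpa using hz (φ i).2 (φ i).1
    simpa using hr
  obtain ⟨i0⟩ : Nonempty w := inferInstance
  let e : Metric.sphere (0 : H) 1 := ⟨b (φ.symm (i0, 0)), by simp [b.orthonormal.1]⟩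
  let g : C(Metric.sphere (0 : H) 1, Metric.sphere (0 : H) 1) :=
    ⟨fun x => ⟨S x, by simp⟩, by fun_prop⟩
  rw [contractible_iff_id_nullhomotopic]
  refine ⟨e, (sphere_homotopic_aux _ g ?_).trans (sphere_homotopic_aux g _ ?_)⟩
  · intro x hx
    have h0 : (x : H) = 0 := hnoeig x hx
    have := x.2
    simp [h0] at this
  · intro x hx
    have hx' : S x + b (φ.symm (i0, 0)) = 0 := hx
    have h1 := congrArg (inner ℂ (b (φ.symm (i0, 0)))) hx'
    rw [inner_add_right, hS0 _ _ (hσ0 i0)] at h1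
    simp [inner_self_eq_norm_sq_to_K, b.orthonormal.1] at h1
end

section
/- Let 𝒰(H) denote the group of unitary operators on H equipped with the strong operator topology, and U(H) the same group with the operator norm topology. Then 𝒰(H) is contractible. Moreover, the contracting homotopy can be chosen continuous in the norm topology except at the last moment: there exists a map F : 𝒰(H) × [0,1] → 𝒰(H) with F(u,0) = u and F(u,1) = id_H for every unitary u, such that F is jointly continuous when the unitary group carries the strong operator topology on both the domain and the codomain, and such that the restriction of F to 𝒰(H) × [0,1) is jointly continuous when the unitary group carries the norm topology on both the domain and the codomain. -/
open Topology Set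

/-- The strong operator topology on the unitary group of `H`, induced by the embedding
`u ↦ (h ↦ u h)` into the product space `H → H`. -/
noncomputable def unitarySOT (H : Type*) [NormedAddCommGroup H] [InnerProductSpace ℂ H]
    [CompleteSpace H] : TopologicalSpace ↥(unitary (H →L[ℂ] H)) :=
  TopologicalSpace.induced (fun u => ((u : H →L[ℂ] H) : H → H))
    (inferInstance : TopologicalSpace (H → H))

open InnerProductSpace in
/-- The unitary `1 - α v v^*`, with `v = x - y`. -/
noncomputable def rotOp {H : Type*} [NormedAddCommGroup H] [InnerProductSpace ℂ H]
    (x y : H) (s : ℝ) : H →L[ℂ] H :=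
  1 - ((s : ℂ) / ((s : ℂ) * (1 - inner ℂ y x) + Complex.I * (1 - s))) •
    rankOne ℂ (x - y) (x - y)

section helpers

variable {H : Type*} [NormedAddCommGroup H] [InnerProductSpace ℂ H]

lemma two_re_aux {x y : H} (hx : ‖x‖ = 1) (hy : ‖y‖ = 1) :
    2 * (1 - inner ℂ y x : ℂ).re = ‖x - y‖ ^ 2 := by
  have h := @norm_sub_sq ℂ H _ _ _ x y
  have h2 : (inner ℂ x y : ℂ).re = (inner ℂ y x : ℂ).re := inner_re_symm (𝕜 := ℂ) x y
  simp only [RCLike.re_to_complex] at h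
  rw [h, hx, hy, h2]
  simp; ring

lemma re_pos_aux {x y : H} (hx : ‖x‖ = 1) (hy : ‖y‖ = 1) (hxy : x ≠ y) :
    0 < (1 - inner ℂ y x : ℂ).re := by
  have h := two_re_aux hx hy
  have h2 : 0 < ‖x - y‖ := norm_pos_iff.2 (sub_ne_zero.2 hxy)
  have : 0 < ‖x - y‖ ^ 2 := by positivity
  linarith

lemma den_ne {q : ℂ} (hq : 0 < q.re) (s : ℝ) :
    (s : ℂ) * q + Complex.I * (1 - s) ≠ 0 := by
  intro h
  have h1 := congrArg Complex.re h
  have h2 := congrArg Complex.im h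
  simp at h1 h2
  rcases h1 with h1 | h1
  · subst h1; simp at h2
  · exact hq.ne' h1

lemma rotOp_zero (x y : H) : rotOp x y 0 = 1 := by simp [rotOp]

lemma rotOp_fix (x y z : H) (s : ℝ) (h1 : inner ℂ x z = 0) (h2 : inner ℂ y z = 0) :
    rotOp x y s z = z := by
  simp [rotOp, h1, h2]

lemma rotOp_one {x y : H} (hx : ‖x‖ = 1) (hy : ‖y‖ = 1) (hxy : x ≠ y) :
    rotOp x y 1 x = y := by
  have h := den_ne (re_pos_aux hx hy hxy) 1
  have h3 : (1 - inner ℂ y x : ℂ) ≠ 0 := by simpa using h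
  have h4 : (inner ℂ x x : ℂ) = 1 := by simp [inner_self_eq_norm_sq_to_K, hx]
  have h5 : (inner ℂ (x - y) x : ℂ) = 1 - inner ℂ y x := by rw [inner_sub_left, h4]
  rw [rotOp, ContinuousLinearMap.sub_apply, ContinuousLinearMap.smul_apply,
    InnerProductSpace.rankOne_apply, h5, smul_smul]
  simp [h3]

lemma rotOp_mem [CompleteSpace H] {x y : H} (hx : ‖x‖ = 1) (hy : ‖y‖ = 1) (hxy : x ≠ y)
    (s : ℝ) : rotOp x y s ∈ unitary (H →L[ℂ] H) := by
  set q : ℂ := 1 - inner ℂ y x with hq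
  have hq0 : 0 < q.re := re_pos_aux hx hy hxy
  set d : ℂ := (s : ℂ) * q + Complex.I * (1 - s) with hd
  have hd0 : d ≠ 0 := den_ne hq0 s
  set P : H →L[ℂ] H := InnerProductSpace.rankOne ℂ (x - y) (x - y) with hP
  have hstar : star P = P := by
    rw [ContinuousLinearMap.star_eq_adjoint, hP, InnerProductSpace.adjoint_rankOne]
  have hPP : P * P = (((2 * q.re : ℝ) : ℂ)) • P := by
    rw [two_re_aux hx hy]
    ext z
    rw [hP, ContinuousLinearMap.mul_apply, ContinuousLinearMap.smul_apply]
    simp only [InnerProductSpace.rankOne_apply, inner_smul_right, smul_smul,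
      inner_self_eq_norm_sq_to_K]
    rw [mul_comm]; simp
  set α : ℂ := (s : ℂ) / d with hα
  have hkey : α + star α = α * star α * ((2 * q.re : ℝ) : ℂ) := by
    have hd1 : star d ≠ 0 := by simpa using hd0
    have hs : star α = (s : ℂ) / star d := by simp [hα]
    have hdd : d + star d = s * ((2 * q.re : ℝ) : ℂ) := by
      apply Complex.ext <;> simp [hd] <;> ring
    rw [hs, hα]
    field_simp
    rw [add_comm, hdd]; ring
  have hR : rotOp x y s = 1 - α • P := rfl
  rw [hR]
  have h1 : star (1 - α • P) = 1 - star α • P := by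
    rw [star_sub, star_smul, hstar, star_one]
  rw [Unitary.mem_iff, h1]
  constructor
  · simp only [sub_mul, mul_sub, one_mul, mul_one, smul_mul_smul_comm, hPP, smul_smul]
    have : star α * α * ((2 * q.re : ℝ) : ℂ) = α + star α := by rw [hkey]; ring
    rw [this, add_smul]; abel
  · simp only [sub_mul, mul_sub, one_mul, mul_one, smul_mul_smul_comm, hPP, smul_smul]
    rw [← hkey, add_smul]; abel

lemma rotOp_continuous {X : Type*} [TopologicalSpace X] {f g : X → H} {c : X → ℝ}
    (hf : Continuous f) (hg : Continuous g) (hc : Continuous c)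
    (hf1 : ∀ a, ‖f a‖ = 1) (hg1 : ∀ a, ‖g a‖ = 1) (hfg : ∀ a, f a ≠ g a) :
    Continuous fun a => rotOp (f a) (g a) (c a) := by
  unfold rotOp
  refine continuous_const.sub (Continuous.smul (Continuous.div (Complex.continuous_ofReal.comp hc) ?_ ?_) ?_)
  · have : Continuous fun a => (inner ℂ (g a) (f a) : ℂ) := hg.inner hf
    fun_prop
  · intro a; exact den_ne (re_pos_aux (hf1 a) (hg1 a) (hfg a)) (c a)
  · have hv := hf.sub hg
    have h1 : Continuous fun a => innerSL ℂ (f a - g a) := (innerSL ℂ).continuous.comp hv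
    exact ((ContinuousLinearMap.smulRightL ℂ H H).continuous.comp h1).clm_apply hv

lemma exists_shift [CompleteSpace H] [TopologicalSpace.SeparableSpace H]
    (hinf : ¬FiniteDimensional ℂ H) :
    ∃ (e : ℕ → H) (S : ℕ → H →ₗᵢ[ℂ] H), Orthonormal ℂ e ∧
      Dense (Submodule.span ℂ (range e) : Set H) ∧
      (∀ n x, ‖x‖ = 1 → x ≠ S n x) ∧ (∀ n x i, i ≤ n → inner ℂ (S n x) (e i) = 0) := by
  obtain ⟨w, b, hb⟩ := exists_hilbertBasis ℂ H
  have hort := b.orthonormal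
  have hcount : Countable w := by
    have hd : (univ : Set w).PairwiseDisjoint (fun i => Metric.ball (b i) (1/2)) := by
      intro i _ j _ hij
      apply Metric.ball_disjoint_ball
      have h1 : ‖b i - b j‖ ^ 2 = 2 := by
        have h := @norm_sub_sq ℂ H _ _ _ (b i) (b j)
        rw [h, hort.1 i, hort.1 j, hort.2 hij]; simp; norm_num
      rw [dist_eq_norm]
      nlinarith [norm_nonneg (b i - b j)]
    have := hd.countable_of_isOpen (fun i _ => Metric.isOpen_ball)
      (fun i _ => ⟨b i, Metric.mem_ball_self (by norm_num)⟩)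
    exact Set.countable_univ_iff.1 this
  have hinfw : Infinite w := by
    by_contra hfin
    have : Finite w := not_infinite_iff_finite.1 hfin
    cases nonempty_fintype w
    exact hinf (b.toOrthonormalBasis.toBasis.finiteDimensional_of_finite)
  obtain ⟨hden⟩ := nonempty_denumerable w
  let φ : ℕ ≃ w := (Denumerable.eqv w).symm
  have hoe : Orthonormal ℂ (b ∘ φ) := hort.comp φ φ.injective
  have hr : range (b ∘ φ) = range b := φ.surjective.range_comp b
  have hsp : ⊤ ≤ (Submodule.span ℂ (range (b ∘ φ))).topologicalClosure := by
    rw [hr, b.dense_span]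
  let B : HilbertBasis ℕ ℂ H := HilbertBasis.mk hoe hsp
  have hBo := B.orthonormal
  have hsh : ∀ n : ℕ, Orthonormal ℂ (fun k => B (k + (n + 1))) := fun n =>
    hBo.comp _ (add_left_injective (n + 1))
  let S : ℕ → H →ₗᵢ[ℂ] H := fun n =>
    (hsh n).orthogonalFamily.linearIsometry.comp B.repr.toLinearIsometry
  have hsum : ∀ n x, HasSum (fun k => (B.repr x k) • B (k + (n+1))) (S n x) := by
    intro n x
    exact (hsh n).orthogonalFamily.hasSum_linearIsometry (B.repr x)
  have hin : ∀ n x j, HasSum (fun k => B.repr x k * inner ℂ (B j) (B (k + (n+1))))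
      (inner ℂ (B j) (S n x)) := by
    intro n x j
    have := (hsum n x).mapL (innerSL ℂ (B j))
    simpa [inner_smul_right] using this
  have horth : ∀ n x i, i ≤ n → inner ℂ (B i) (S n x) = 0 := by
    intro n x i hi
    refine (hin n x i).unique ?_
    convert hasSum_zero using 2 with k
    rw [hBo.2 (by omega : i ≠ k + (n+1)), mul_zero]
  have hcoef : ∀ n x j, inner ℂ (B (j + (n+1))) (S n x) = inner ℂ (B j) x := by
    intro n x j
    refine (hin n x _).unique ?_
    convert hasSum_single j ?_ using 1
    · rw [inner_self_eq_norm_sq_to_K, hBo.1, B.repr_apply_apply]; simp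
    · intro k hk
      rw [hBo.2 (by omega : j + (n+1) ≠ k + (n+1)), mul_zero]
  refine ⟨B, S, hBo, ?_, ?_, ?_⟩
  · rw [Submodule.dense_iff_topologicalClosure_eq_top]
    exact B.dense_span
  · intro n x hx hfix
    have hz : ∀ j, inner ℂ (B j) x = 0 := by
      intro j
      induction j using Nat.strong_induction_on with
      | _ j ih =>
        by_cases hj : j ≤ n
        · rw [hfix]; exact horth n x j hj
        · obtain ⟨m, rfl⟩ : ∃ m, j = m + (n+1) := ⟨j - (n+1), by omega⟩
          rw [hfix, hcoef]; exact ih m (by omega)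
    have : B.repr x = 0 := by
      ext j
      rw [B.repr_apply_apply, hz]; rfl
    have : x = 0 := by simpa using this
    simp [this] at hx
  · intro n x i hi
    rw [← inner_conj_symm, horth n x i hi, map_zero]

end helpers

section main

variable {H : Type*} [NormedAddCommGroup H] [InnerProductSpace ℂ H] [CompleteSpace H]

lemma unitary_norm (u : unitary (H →L[ℂ] H)) (x : H) : ‖(u : H →L[ℂ] H) x‖ = ‖x‖ :=
  (Unitary.linearIsometryEquiv u).norm_map x

lemma unitary_inner (u : unitary (H →L[ℂ] H)) (x y : H) :
    inner ℂ ((u : H →L[ℂ] H) x) ((u : H →L[ℂ] H) y) = (inner ℂ x y : ℂ) :=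
  (Unitary.linearIsometryEquiv u).inner_map_map x y

/-- Data for the construction. -/
structure ShiftData (H : Type*) [NormedAddCommGroup H] [InnerProductSpace ℂ H] where
  e : ℕ → H
  S : ℕ → H →ₗᵢ[ℂ] H
  on : Orthonormal ℂ e
  dense : Dense (Submodule.span ℂ (range e) : Set H)
  ne : ∀ n x, ‖x‖ = 1 → x ≠ S n x
  orth : ∀ n x i, i ≤ n → inner ℂ (S n x) (e i) = 0

lemma ShiftData.ne_e (D : ShiftData H) (n : ℕ) (x : H) : D.S n x ≠ D.e n := by
  intro h
  have := D.orth n x n le_rfl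
  rw [h, inner_self_eq_norm_sq_to_K, D.on.1] at this
  simp at this

lemma ShiftData.norm_ue (D : ShiftData H) (n : ℕ) (u : unitary (H →L[ℂ] H)) :
    ‖(u : H →L[ℂ] H) (D.e n)‖ = 1 := by rw [unitary_norm, D.on.1]

/-- The operator moving `x` to `e n`. -/
noncomputable def moveOp (D : ShiftData H) (n : ℕ) (x : H) (s : ℝ) : H →L[ℂ] H :=
  rotOp (D.S n x) (D.e n) s * rotOp x (D.S n x) s

/-- One step of the deformation. -/
noncomputable def stepMap (D : ShiftData H) (n : ℕ) (u : unitary (H →L[ℂ] H)) (s : ℝ) :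
    unitary (H →L[ℂ] H) :=
  ⟨moveOp D n ((u : H →L[ℂ] H) (D.e n)) s * u, by
    have h1 := D.norm_ue n u
    refine mul_mem (mul_mem (rotOp_mem ?_ (D.on.1 n) (D.ne_e n _) s)
      (rotOp_mem h1 ?_ (D.ne n _ h1) s)) u.2 <;> rw [LinearIsometry.norm_map, h1]⟩

/-- The clamped time of step `n`. -/
noncomputable def clampT (n : ℕ) (t : ℝ) : ℝ :=
  max 0 (min 1 ((n + 1) * (n + 2) * (t - (1 - 1 / (n + 1)))))

lemma clampT_continuous (n : ℕ) : Continuous (clampT n) := by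
  unfold clampT; fun_prop

lemma clampT_zero {n : ℕ} {t : ℝ} (h : t ≤ 1 - 1 / ((n : ℝ) + 1)) : clampT n t = 0 := by
  unfold clampT
  apply max_eq_left
  apply (min_le_right _ _).trans
  exact mul_nonpos_of_nonneg_of_nonpos (by positivity) (by linarith)

lemma clampT_one {n : ℕ} {t : ℝ} (h : 1 - 1 / ((n : ℝ) + 2) ≤ t) : clampT n t = 1 := by
  unfold clampT
  have : (1 : ℝ) ≤ (n + 1) * (n + 2) * (t - (1 - 1 / (n + 1))) := by
    calc (1 : ℝ) = (n + 1) * (n + 2) * ((1 - 1 / ((n : ℝ) + 2)) - (1 - 1 / (n + 1))) := by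
          field_simp; ring
      _ ≤ _ := by gcongr
  rw [min_eq_left this]; norm_num

/-- The first `n` steps of the deformation. -/
noncomputable def stages (D : ShiftData H) (u : unitary (H →L[ℂ] H)) (t : ℝ) :
    ℕ → unitary (H →L[ℂ] H)
  | 0 => u
  | n + 1 => stepMap D n (stages D u t n) (clampT n t)

lemma stages_stable (D : ShiftData H) (u : unitary (H →L[ℂ] H)) {t : ℝ} {n m : ℕ}
    (h : t ≤ 1 - 1 / ((n : ℝ) + 1)) (hnm : n ≤ m) : stages D u t m = stages D u t n := by
  induction m, hnm using Nat.le_induction with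
  | base => rfl
  | succ m hm ih =>
    have hm' : (n : ℝ) ≤ m := by exact_mod_cast hm
    have : t ≤ 1 - 1 / ((m : ℝ) + 1) := h.trans (by gcongr)
    rw [stages, clampT_zero this, ← ih]
    apply Subtype.ext
    simp [stepMap, moveOp, rotOp_zero]

lemma stages_fix (D : ShiftData H) (u : unitary (H →L[ℂ] H)) {t : ℝ} {i : ℕ}
    (h : 1 - 1 / ((i : ℝ) + 2) ≤ t) {m : ℕ} (hm : i < m) :
    (stages D u t m : H →L[ℂ] H) (D.e i) = D.e i := by
  induction m with
  | zero => omega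
  | succ m ih =>
    have h1 := D.norm_ue m (stages D u t m)
    rcases Nat.lt_succ_iff_lt_or_eq.1 hm with hi | rfl
    · have h0 := ih hi
      have hx : inner ℂ ((stages D u t m : H →L[ℂ] H) (D.e m)) (D.e i) = 0 := by
        conv_lhs => rw [← h0]
        rw [unitary_inner, D.on.2 hi.ne']
      have hS := D.orth m ((stages D u t m : H →L[ℂ] H) (D.e m)) i hi.le
      simp only [stages, stepMap, moveOp, ContinuousLinearMap.mul_apply, h0]
      rw [rotOp_fix _ _ _ _ hx hS, rotOp_fix _ _ _ _ hS (D.on.2 hi.ne')]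
    · simp only [stages, stepMap, moveOp, ContinuousLinearMap.mul_apply, clampT_one h]
      rw [rotOp_one h1 (by rw [LinearIsometry.norm_map, h1]) (D.ne i _ h1),
        rotOp_one (by rw [LinearIsometry.norm_map, h1]) (D.on.1 i) (D.ne_e i _)]

lemma moveOp_continuous (D : ShiftData H) (n : ℕ) {X : Type*} [TopologicalSpace X]
    {f : X → H} {c : X → ℝ} (hf : Continuous f) (hc : Continuous c) (hf1 : ∀ a, ‖f a‖ = 1) :
    Continuous fun a => moveOp D n (f a) (c a) := by
  have hS : Continuous fun a => D.S n (f a) := (D.S n).continuous.comp hf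
  have hS1 : ∀ a, ‖D.S n (f a)‖ = 1 := fun a => by rw [LinearIsometry.norm_map, hf1]
  exact (rotOp_continuous hS continuous_const hc hS1 (fun _ => D.on.1 n)
    (fun a => D.ne_e n _)).mul (rotOp_continuous hf hS hc hf1 hS1 (fun a => D.ne n _ (hf1 a)))

lemma stages_continuous_sot (D : ShiftData H) {X : Type*} [TopologicalSpace X]
    {f : X → unitary (H →L[ℂ] H)} {t : X → ℝ}
    (hf : ∀ h, Continuous fun a => (f a : H →L[ℂ] H) h) (ht : Continuous t) (n : ℕ) :
    ∀ h, Continuous fun a => (stages D (f a) (t a) n : H →L[ℂ] H) h := by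
  induction n with
  | zero => exact hf
  | succ n ih =>
    intro h
    exact (moveOp_continuous D n (ih (D.e n)) ((clampT_continuous n).comp ht)
      (fun a => D.norm_ue n _)).clm_apply (ih h)

lemma stages_continuous_norm (D : ShiftData H) {X : Type*} [TopologicalSpace X]
    {f : X → unitary (H →L[ℂ] H)} {t : X → ℝ}
    (hf : Continuous f) (ht : Continuous t) (n : ℕ) :
    Continuous fun a => stages D (f a) (t a) n := by
  induction n with
  | zero => exact hf
  | succ n ih =>
    have ih' := continuous_subtype_val.comp ih
    refine Continuous.subtype_mk ?_ _
    exact (moveOp_continuous D n (ih'.clm_apply continuous_const) ((clampT_continuous n).comp ht)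
      (fun a => D.norm_ue n _)).mul ih'

open Classical in
/-- The full deformation. -/
noncomputable def deform (D : ShiftData H) (u : unitary (H →L[ℂ] H)) (t : ℝ) :
    unitary (H →L[ℂ] H) :=
  if t < 1 then stages D u t ⌈1 / (1 - t)⌉₊ else 1

lemma le_of_ceil {t : ℝ} (ht : t < 1) : t ≤ 1 - 1 / (((⌈1 / (1 - t)⌉₊ : ℕ) : ℝ) + 1) := by
  have h1 : 0 < 1 - t := by linarith
  have h2 : 1 / (1 - t) ≤ (⌈1 / (1 - t)⌉₊ : ℝ) := Nat.le_ceil _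
  have h3 : 1 / (((⌈1 / (1 - t)⌉₊ : ℕ) : ℝ) + 1) ≤ 1 - t := by
    rw [div_le_iff₀ (by positivity)]
    rw [div_le_iff₀ h1] at h2
    nlinarith
  linarith

lemma deform_eq (D : ShiftData H) (u : unitary (H →L[ℂ] H)) {t : ℝ} {n : ℕ}
    (h : t ≤ 1 - 1 / ((n : ℝ) + 1)) : deform D u t = stages D u t n := by
  have : (0 : ℝ) < 1 / ((n : ℝ) + 1) := by positivity
  have ht : t < 1 := by linarith
  rw [deform, if_pos ht, ← stages_stable D u (le_of_ceil ht) (le_max_left _ n),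
    ← stages_stable D u h (le_max_right _ n)]

lemma deform_zero (D : ShiftData H) (u : unitary (H →L[ℂ] H)) : deform D u 0 = u := by
  rw [deform_eq D u (n := 0) (by simp)]; rfl

lemma deform_one (D : ShiftData H) (u : unitary (H →L[ℂ] H)) : deform D u 1 = 1 := by
  simp [deform]

lemma deform_fix (D : ShiftData H) (u : unitary (H →L[ℂ] H)) {t : ℝ} {i : ℕ}
    (h : 1 - 1 / ((i : ℝ) + 2) ≤ t) : (deform D u t : H →L[ℂ] H) (D.e i) = D.e i := by
  by_cases ht : t < 1
  · rw [deform, if_pos ht, ← stages_stable D u (le_of_ceil ht) (le_max_left _ (i + 1))]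
    exact stages_fix D u h (lt_of_lt_of_le (Nat.lt_succ_self i) (le_max_right _ _))
  · simp [deform, ht]

lemma deform_fix_span (D : ShiftData H) {g : H} (hg : g ∈ Submodule.span ℂ (range D.e)) :
    ∃ δ < (1 : ℝ), ∀ (u : unitary (H →L[ℂ] H)) (t : ℝ), δ ≤ t →
      (deform D u t : H →L[ℂ] H) g = g := by
  induction hg using Submodule.span_induction with
  | mem x hx =>
    obtain ⟨i, rfl⟩ := hx
    refine ⟨1 - 1 / ((i : ℝ) + 2), ?_, fun u t h => deform_fix D u h⟩
    have : (0 : ℝ) < 1 / ((i : ℝ) + 2) := by positivity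
    linarith
  | zero => exact ⟨0, by norm_num, fun u t _ => map_zero _⟩
  | add x y _ _ hx hy =>
    obtain ⟨a, ha, hx⟩ := hx
    obtain ⟨b, hb, hy⟩ := hy
    refine ⟨max a b, max_lt ha hb, fun u t h => ?_⟩
    rw [map_add, hx u t ((le_max_left _ _).trans h), hy u t ((le_max_right _ _).trans h)]
  | smul c x _ hx =>
    obtain ⟨a, ha, hx⟩ := hx
    exact ⟨a, ha, fun u t h => by rw [map_smul, hx u t h]⟩

lemma eventually_stage {X : Type*} [TopologicalSpace X] {t : X → ℝ}
    (ht : Continuous t) {a : X} (ha : t a < 1) :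
    ∃ n : ℕ, ∀ᶠ x in 𝓝 a, t x ≤ 1 - 1 / ((n : ℝ) + 1) := by
  have h1 : 0 < 1 - t a := by linarith
  obtain ⟨n, hn⟩ := exists_nat_one_div_lt h1
  refine ⟨n, ?_⟩
  have : ∀ᶠ x in 𝓝 a, t x < 1 - 1 / ((n : ℝ) + 1) :=
    ht.continuousAt.eventually_lt continuousAt_const (by linarith)
  exact this.mono fun x hx => hx.le

lemma deform_continuous_sot (D : ShiftData H) {X : Type*} [TopologicalSpace X]
    {f : X → unitary (H →L[ℂ] H)} {t : X → ℝ}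
    (hf : ∀ h, Continuous fun a => (f a : H →L[ℂ] H) h) (ht : Continuous t)
    (ht1 : ∀ a, t a ≤ 1) (h : H) :
    Continuous fun a => (deform D (f a) (t a) : H →L[ℂ] H) h := by
  rw [continuous_iff_continuousAt]
  intro a
  rcases (ht1 a).lt_or_eq with ha | ha
  · obtain ⟨n, hn⟩ := eventually_stage ht ha
    refine (stages_continuous_sot D hf ht n h).continuousAt.congr ?_
    filter_upwards [hn] with x hx
    rw [deform_eq D _ hx]
  · rw [Metric.continuousAt_iff']
    intro ε hε
    obtain ⟨g, hg, hgh⟩ := Metric.dense_iff.1 D.dense h (ε / 2) (by linarith)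
    obtain ⟨δ, hδ, hfix⟩ := deform_fix_span D hgh
    have : ∀ᶠ x in 𝓝 a, δ < t x :=
      continuousAt_const.eventually_lt ht.continuousAt (by rw [ha]; exact hδ)
    filter_upwards [this] with x hx
    rw [ha, deform_one]
    have h1 := hfix (f x) (t x) hx.le
    calc dist ((deform D (f x) (t x) : H →L[ℂ] H) h) h
        ≤ dist ((deform D (f x) (t x) : H →L[ℂ] H) h)
            ((deform D (f x) (t x) : H →L[ℂ] H) g) + dist g h := by
          conv_rhs => rw [h1]
          exact dist_triangle _ _ _
      _ = dist h g + dist g h := by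
          rw [dist_eq_norm, ← map_sub, unitary_norm, ← dist_eq_norm]
      _ < ε := by
          rw [dist_comm h g]
          have := Metric.mem_ball.1 hg
          linarith

lemma deform_continuous_norm (D : ShiftData H) {X : Type*} [TopologicalSpace X]
    {f : X → unitary (H →L[ℂ] H)} {t : X → ℝ}
    (hf : Continuous f) (ht : Continuous t) {a : X} (ha : t a < 1) :
    ContinuousAt (fun a => deform D (f a) (t a)) a := by
  obtain ⟨n, hn⟩ := eventually_stage ht ha
  refine (stages_continuous_norm D hf ht n).continuousAt.congr ?_
  filter_upwards [hn] with x hx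
  rw [deform_eq D _ hx]

/-- Type synonym for the unitary group carrying the strong operator topology. -/
def USot (H : Type*) [NormedAddCommGroup H] [InnerProductSpace ℂ H] [CompleteSpace H] :=
  ↥(unitary (H →L[ℂ] H))

noncomputable instance : TopologicalSpace (USot H) := unitarySOT H

/-- The underlying unitary. -/
def USot.un (u : USot H) : ↥(unitary (H →L[ℂ] H)) := u

lemma usot_continuous_iff {X : Type*} [TopologicalSpace X] {f : X → USot H} :
    Continuous f ↔ ∀ h, Continuous fun a => ((f a).un : H →L[ℂ] H) h := by
  refine continuous_induced_rng.trans ?_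
  exact continuous_pi_iff

lemma usot_eval (h : H) : Continuous fun u : USot H => (u.un : H →L[ℂ] H) h :=
  usot_continuous_iff.1 continuous_id h

/-- `deform` on the synonym. -/
noncomputable def deformS (D : ShiftData H) (u : USot H) (t : ℝ) : USot H := deform D u.un t

lemma usot_contractible (D : ShiftData H) : ContractibleSpace (USot H) := by
  rw [contractible_iff_id_nullhomotopic]
  refine ⟨(1 : ↥(unitary (H →L[ℂ] H))), ⟨⟨⟨fun p => deformS D p.2 p.1, ?_⟩, ?_, ?_⟩⟩⟩
  · rw [usot_continuous_iff]
    intro h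
    exact deform_continuous_sot D (f := fun p : unitInterval × USot H => p.2.un)
      (t := fun p => (p.1 : ℝ))
      (fun h => (usot_eval h).comp continuous_snd) (by fun_prop) (fun p => p.1.2.2) h
  · intro u; exact deform_zero D u
  · intro u; exact deform_one D u

lemma usot_continuousOn (D : ShiftData H) :
    ContinuousOn (fun p : USot H × ℝ => deformS D p.1 p.2) (univ ×ˢ Icc (0 : ℝ) 1) := by
  rw [continuousOn_iff_continuous_restrict, usot_continuous_iff]
  intro h
  exact deform_continuous_sot D
    (f := fun p : (univ ×ˢ Icc (0 : ℝ) 1 : Set (USot H × ℝ)) => p.1.1.un)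
    (t := fun p => p.1.2)
    (fun h => (usot_eval h).comp (continuous_fst.comp continuous_subtype_val))
    (by fun_prop) (fun p => p.2.2.2) h

end main

/-- `𝒰(H)` with the strong operator topology is contractible; moreover, the contracting
homotopy can be chosen continuous in the norm topology except at the last moment. -/
theorem stmt7 {H : Type*} [NormedAddCommGroup H] [InnerProductSpace ℂ H]
    [CompleteSpace H] [TopologicalSpace.SeparableSpace H]
    (hinf : ¬FiniteDimensional ℂ H) :
    @ContractibleSpace ↥(unitary (H →L[ℂ] H)) (unitarySOT H) ∧
    ∃ F : ↥(unitary (H →L[ℂ] H)) → ℝ → ↥(unitary (H →L[ℂ] H)),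
      (∀ u, F u 0 = u) ∧ (∀ u, F u 1 = 1) ∧
      @ContinuousOn (↥(unitary (H →L[ℂ] H)) × ℝ) ↥(unitary (H →L[ℂ] H))
        (@instTopologicalSpaceProd _ _ (unitarySOT H) inferInstance) (unitarySOT H)
        (fun p => F p.1 p.2) (univ ×ˢ Icc (0 : ℝ) 1) ∧
      ContinuousOn (fun p : ↥(unitary (H →L[ℂ] H)) × ℝ => F p.1 p.2)
        (univ ×ˢ Ico (0 : ℝ) 1) := by
  obtain ⟨e, S, h1, h2, h3, h4⟩ := exists_shift hinf
  let D : ShiftData H := ⟨e, S, h1, h2, h3, h4⟩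
  refine ⟨usot_contractible D, deform D, deform_zero D, deform_one D, usot_continuousOn D, ?_⟩
  intro p hp
  exact (deform_continuous_norm D continuous_fst continuous_snd hp.2.2).continuousWithinAt
end

section
/- Let Isom(H) denote the set of linear isometric embeddings H → H (bounded linear maps u with ‖u(h)‖ = ‖h‖ for all h). Then Isom(H) with the strong operator topology is contractible: there exists a map F : Isom(H) × [0,1] → Isom(H) with F(u,0) = u and F(u,1) = id_H for every u, such that F is jointly continuous when Isom(H) carries the strong operator topology on both the domain and the codomain, and such that the restriction of F to Isom(H) × [0,1) is jointly continuous when Isom(H) carries the operator norm topology on both the domain and the codomain. -/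
open Topology Set

/-- The strong operator topology on the space of linear isometric embeddings `H → H`,
induced by the embedding `u ↦ (h ↦ u h)` into the product space `H → H`. -/
noncomputable def isomSOT (H : Type*) [NormedAddCommGroup H] [InnerProductSpace ℂ H] :
    TopologicalSpace {u : H →L[ℂ] H // ∀ h : H, ‖u h‖ = ‖h‖} :=
  TopologicalSpace.induced (fun u => ((u.1 : H →L[ℂ] H) : H → H))
    (inferInstance : TopologicalSpace (H → H))


section aux
variable {H : Type*} [NormedAddCommGroup H] [InnerProductSpace ℂ H]

noncomputable def rfl2 (x y : H) : H →L[ℂ] H :=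
  -(ContinuousLinearMap.id ℂ H) +
    (1 + inner ℂ y x)⁻¹ • (innerSL ℂ (x + y)).smulRight (x + y)

lemma rfl2_apply (x y z : H) :
    rfl2 x y z = -z + (1 + inner ℂ y x)⁻¹ • (inner ℂ (x + y) z : ℂ) • (x + y) := by
  simp [rfl2]

lemma rfl2_norm {x y : H} (hx : ‖x‖ = 1) (hy : ‖y‖ = 1) (z : H) : ‖rfl2 x y z‖ = ‖z‖ := by
  rw [rfl2_apply]
  set d : ℂ := 1 + inner ℂ y x with hd
  set w := x + y with hw
  have hww : ‖w‖ ^ 2 = 2 * d.re := by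
    rw [hw, hd, norm_add_sq (𝕜 := ℂ), hx, hy]
    have : (inner ℂ y x : ℂ).re = (inner ℂ x y : ℂ).re := by
      rw [← inner_conj_symm, Complex.conj_re]
    simp [this]; ring
  have : ‖-z + d⁻¹ • (inner ℂ w z : ℂ) • w‖ ^ 2 = ‖z‖ ^ 2 := by
    rw [norm_add_sq (𝕜 := ℂ), norm_neg, norm_smul, norm_smul, mul_pow, mul_pow, hww,
      inner_neg_left, inner_smul_right, inner_smul_right]
    have h2 : (inner ℂ w z : ℂ) * inner ℂ z w = ((‖(inner ℂ w z : ℂ)‖ ^ 2 : ℝ) : ℂ) := by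
      rw [← inner_conj_symm z w, Complex.mul_conj, Complex.normSq_eq_norm_sq]
    rw [h2, norm_inv, ← Complex.normSq_eq_norm_sq, inv_pow, ← Complex.normSq_eq_norm_sq]
    simp only [map_neg, RCLike.re_to_complex, Complex.re_mul_ofReal, Complex.inv_re]
    ring
  exact (sq_eq_sq₀ (norm_nonneg _) (norm_nonneg _)).1 this

lemma one_add_inner_ne {x y : H} (hx : ‖x‖ = 1) (hy : ‖y‖ = 1) (h : x + y ≠ 0) :
    (1 + inner ℂ y x : ℂ) ≠ 0 := by
  intro h0
  apply h
  have : ‖x + y‖ ^ 2 = 0 := by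
    rw [add_comm, norm_add_sq (𝕜 := ℂ), hx, hy]
    have : (inner ℂ y x : ℂ) = -1 := by linear_combination h0
    rw [this]; norm_num
  simpa using this

lemma rfl2_self {x y : H} (hx : ‖x‖ = 1) (hy : ‖y‖ = 1) (h : x + y ≠ 0) :
    rfl2 x y x = y := by
  have h1 := one_add_inner_ne hx hy h
  have h2 : (inner ℂ (x + y) x : ℂ) = 1 + inner ℂ y x := by
    rw [inner_add_left, inner_self_eq_norm_sq_to_K, hx]; simp
  rw [rfl2_apply, h2, smul_smul, inv_mul_cancel₀ h1]; simp

noncomputable def rot (x y : H) : H →L[ℂ] H := (rfl2 x y).comp (rfl2 x x)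

lemma rot_norm {x y : H} (hx : ‖x‖ = 1) (hy : ‖y‖ = 1) (z : H) : ‖rot x y z‖ = ‖z‖ := by
  simp [rot, rfl2_norm hx hy, rfl2_norm hx hx]

lemma self_ne {x : H} (hx : ‖x‖ = 1) : x + x ≠ 0 := by
  intro h
  have : x = 0 := by
    have h2 : (2 : ℂ) • x = 0 := by rw [two_smul]; exact h
    simpa using h2
  simp [this] at hx

lemma rot_self {x y : H} (hx : ‖x‖ = 1) (hy : ‖y‖ = 1) (h : x + y ≠ 0) :
    rot x y x = y := by
  simp [rot, rfl2_self hx hy h, rfl2_self hx hx (self_ne hx)]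

lemma rot_same {x : H} (hx : ‖x‖ = 1) : rot x x = ContinuousLinearMap.id ℂ H := by
  ext z
  have h0 := rfl2_self hx hx (self_ne hx)
  have : rfl2 x x z = - z + (2 * inner ℂ x z : ℂ) • x := by
    rw [rfl2_apply, inner_self_eq_norm_sq_to_K, hx, inner_add_left, ← two_smul ℂ x,
      smul_smul, smul_smul]
    congr 2
    norm_num
    ring
  simp only [rot, ContinuousLinearMap.comp_apply]
  conv_lhs => rw [this]
  rw [map_add, map_neg, map_smul, h0, this]
  simp

lemma rfl2_perp {x y z : H} (hx : inner ℂ x z = (0 : ℂ)) (hy : inner ℂ y z = (0 : ℂ)) :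
    rfl2 x y z = - z := by
  simp [rfl2_apply, hx, hy]

lemma rot_perp {x y z : H} (hx : inner ℂ x z = (0 : ℂ)) (hy : inner ℂ y z = (0 : ℂ)) :
    rot x y z = z := by
  simp [rot, rfl2_perp hx hy, rfl2_perp hx hx]

lemma rfl2_cont {Y : Type*} [TopologicalSpace Y] {x y : Y → H} (hx : Continuous x)
    (hy : Continuous y) (hx1 : ∀ a, ‖x a‖ = 1) (hy1 : ∀ a, ‖y a‖ = 1)
    (h : ∀ a, x a + y a ≠ 0) : Continuous (fun a => rfl2 (x a) (y a)) := by
  unfold rfl2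
  refine continuous_const.add (Continuous.fun_smul ?_ ?_)
  · exact (continuous_const.add (hy.inner hx)).inv₀
      fun a => one_add_inner_ne (hx1 a) (hy1 a) (h a)
  · have h1 : Continuous fun a => innerSL ℂ (x a + y a) := (innerSL ℂ).continuous.comp (hx.add hy)
    have h2 : Continuous fun a => ContinuousLinearMap.smulRightL ℂ H H (innerSL ℂ (x a + y a)) (x a + y a) :=
      (((ContinuousLinearMap.smulRightL ℂ H H).continuous.comp h1).clm_apply (hx.add hy))
    exact h2

lemma rot_cont {Y : Type*} [TopologicalSpace Y] {x y : Y → H} (hx : Continuous x)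
    (hy : Continuous y) (hx1 : ∀ a, ‖x a‖ = 1) (hy1 : ∀ a, ‖y a‖ = 1)
    (h : ∀ a, x a + y a ≠ 0) : Continuous (fun a => rot (x a) (y a)) := by
  unfold rot
  exact (rfl2_cont hx hy hx1 hy1 h).clm_comp (rfl2_cont hx hx hx1 hx1 fun a => self_ne (hx1 a))

noncomputable def clamp (t : ℝ) : ℝ := max 0 (min 1 t)

lemma clamp_cont : Continuous clamp := by unfold clamp; fun_prop
lemma clamp_nonneg (t : ℝ) : 0 ≤ clamp t := le_max_left _ _
lemma clamp_le (t : ℝ) : clamp t ≤ 1 := by simp [clamp]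
lemma clamp_of_le {t : ℝ} (h : t ≤ 0) : clamp t = 0 := by
  unfold clamp; rw [min_eq_right (by linarith), max_eq_left h]
lemma clamp_of_ge {t : ℝ} (h : 1 ≤ t) : clamp t = 1 := by
  unfold clamp; rw [min_eq_left h, max_eq_right zero_le_one]

noncomputable def seg (x y : H) (t : ℝ) : H := ((1 - clamp t : ℝ) : ℂ) • x + ((clamp t : ℝ) : ℂ) • y

noncomputable def gam (x y : H) (t : ℝ) : H := ((‖seg x y t‖⁻¹ : ℝ) : ℂ) • seg x y t

lemma comb_ne {x y : H} (hx : ‖x‖ = 1) (hy : ‖y‖ = 1) (h : x + y ≠ 0) {a b : ℝ}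
    (ha : 0 ≤ a) (hb : 0 ≤ b) (hab : 0 < a + b) : (a : ℂ) • x + (b : ℂ) • y ≠ 0 := by
  intro h0
  have h1 : (a : ℂ) • x = -((b : ℂ) • y) := eq_neg_of_add_eq_zero_left h0
  have h2 : a = b := by
    have := congrArg norm h1
    simpa [norm_smul, hx, hy, abs_of_nonneg, ha, hb] using this
  subst h2
  rw [← smul_add] at h0
  rcases smul_eq_zero.1 h0 with h3 | h3
  · have : a = 0 := by exact_mod_cast h3
    linarith
  · exact h h3

lemma seg_ne {x y : H} (hx : ‖x‖ = 1) (hy : ‖y‖ = 1) (h : x + y ≠ 0) (t : ℝ) :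
    seg x y t ≠ 0 :=
  comb_ne hx hy h (by linarith [clamp_le t]) (clamp_nonneg t) (by linarith)

lemma gam_norm {x y : H} (hx : ‖x‖ = 1) (hy : ‖y‖ = 1) (h : x + y ≠ 0) (t : ℝ) :
    ‖gam x y t‖ = 1 := by
  have := seg_ne hx hy h t
  rw [gam, norm_smul]
  simp [this]

lemma gam_ne {x y : H} (hx : ‖x‖ = 1) (hy : ‖y‖ = 1) (h : x + y ≠ 0) (t : ℝ) :
    x + gam x y t ≠ 0 := by
  have h1 := norm_pos_iff.2 (seg_ne hx hy h t)
  have h2 := inv_pos.2 h1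
  have h3 := clamp_le t
  have h4 := clamp_nonneg t
  have : x + gam x y t = ((1 + ‖seg x y t‖⁻¹ * (1 - clamp t) : ℝ) : ℂ) • x
      + ((‖seg x y t‖⁻¹ * clamp t : ℝ) : ℂ) • y := by
    rw [gam]
    generalize ‖seg x y t‖⁻¹ = c
    rw [seg]
    push_cast
    module
  rw [this]
  have h5 := mul_nonneg h2.le (sub_nonneg.2 h3)
  have h6 := mul_nonneg h2.le h4
  exact comb_ne hx hy h (by linarith) h6 (by linarith)

lemma gam_zero {x y : H} (hx : ‖x‖ = 1) {t : ℝ} (ht : t ≤ 0) : gam x y t = x := by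
  simp [gam, seg, clamp_of_le ht, hx]

lemma gam_one {x y : H} (hy : ‖y‖ = 1) {t : ℝ} (ht : 1 ≤ t) : gam x y t = y := by
  simp [gam, seg, clamp_of_ge ht, hy]

lemma gam_perp {x y z : H} (hx : inner ℂ x z = (0 : ℂ)) (hy : inner ℂ y z = (0 : ℂ)) (t : ℝ) :
    inner ℂ (gam x y t) z = (0 : ℂ) := by
  simp [gam, seg, hx, hy]

lemma gam_cont {Y : Type*} [TopologicalSpace Y] {x y : Y → H} {t : Y → ℝ} (hx : Continuous x)
    (hy : Continuous y) (ht : Continuous t) (hx1 : ∀ a, ‖x a‖ = 1) (hy1 : ∀ a, ‖y a‖ = 1)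
    (h : ∀ a, x a + y a ≠ 0) : Continuous (fun a => gam (x a) (y a) (t a)) := by
  have hc : Continuous fun a => clamp (t a) := clamp_cont.comp ht
  have hs : Continuous (fun a => seg (x a) (y a) (t a)) := by
    unfold seg
    exact ((Complex.continuous_ofReal.comp (continuous_const.sub hc)).smul hx).add
      ((Complex.continuous_ofReal.comp hc).smul hy)
  unfold gam
  exact (Complex.continuous_ofReal.comp (hs.norm.inv₀ fun a =>
    (norm_pos_iff.2 (seg_ne (hx1 a) (hy1 a) (h a) _)).ne')).smul hs

/-- Two-stage rotation moving `x` to `e` through `y`. -/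
noncomputable def mov (x y e : H) (r : ℝ) : H →L[ℂ] H :=
  (rot y (gam y e (2 * r - 1))).comp (rot x (gam x y (2 * r)))

lemma mov_norm {x y e : H} (hx : ‖x‖ = 1) (hy : ‖y‖ = 1) (he : ‖e‖ = 1) (h : x + y ≠ 0)
    (h' : y + e ≠ 0) (r : ℝ) (z : H) : ‖mov x y e r z‖ = ‖z‖ := by
  simp [mov, rot_norm hy (gam_norm hy he h' _), rot_norm hx (gam_norm hx hy h _)]

lemma mov_zero {x y e : H} (hx : ‖x‖ = 1) (hy : ‖y‖ = 1) {r : ℝ} (hr : r ≤ 0) :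
    mov x y e r = ContinuousLinearMap.id ℂ H := by
  rw [mov, gam_zero hy (by linarith), gam_zero hx (by linarith), rot_same hx, rot_same hy]
  rfl

lemma mov_one {x y e : H} (hx : ‖x‖ = 1) (hy : ‖y‖ = 1) (he : ‖e‖ = 1) (h : x + y ≠ 0)
    (h' : y + e ≠ 0) {r : ℝ} (hr : 1 ≤ r) : mov x y e r x = e := by
  rw [mov, gam_one he (by linarith), gam_one hy (by linarith), ContinuousLinearMap.comp_apply,
    rot_self hx hy h, rot_self hy he h']

lemma mov_perp {x y e z : H} (hx : inner ℂ x z = (0 : ℂ)) (hy : inner ℂ y z = (0 : ℂ))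
    (he : inner ℂ e z = (0 : ℂ)) (r : ℝ) : mov x y e r z = z := by
  rw [mov, ContinuousLinearMap.comp_apply, rot_perp hx (gam_perp hx hy _),
    rot_perp hy (gam_perp hy he _)]

lemma mov_cont {Y : Type*} [TopologicalSpace Y] {x y : Y → H} {e : H} {r : Y → ℝ}
    (hx : Continuous x) (hy : Continuous y) (hr : Continuous r) (hx1 : ∀ a, ‖x a‖ = 1)
    (hy1 : ∀ a, ‖y a‖ = 1) (he : ‖e‖ = 1) (h : ∀ a, x a + y a ≠ 0) (h' : ∀ a, y a + e ≠ 0) :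
    Continuous (fun a => mov (x a) (y a) e (r a)) := by
  unfold mov
  refine Continuous.clm_comp ?_ ?_
  · exact rot_cont hy (gam_cont hy continuous_const (by fun_prop) hy1 (fun _ => he) h') hy1
      (fun a => gam_norm (hy1 a) he (h' a) _) (fun a => gam_ne (hy1 a) he (h' a) _)
  · exact rot_cont hx (gam_cont hx hy (by fun_prop) hx1 hy1 h) hx1
      (fun a => gam_norm (hx1 a) (hy1 a) (h a) _) (fun a => gam_ne (hx1 a) (hy1 a) (h a) _)
end aux

section main
universe u
variable {H : Type u} [NormedAddCommGroup H] [InnerProductSpace ℂ H]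

lemma exists_onb [CompleteSpace H] [TopologicalSpace.SeparableSpace H]
    (hinf : ¬FiniteDimensional ℂ H) : Nonempty (HilbertBasis ℕ ℂ H) := by
  obtain ⟨w, b, hb⟩ := exists_hilbertBasis ℂ H
  have ho := b.orthonormal
  have hc : Countable w := by
    refine Pairwise.countable_of_isOpen_disjoint (s := fun i : w => Metric.ball (b i) (1/2)) ?_
      (fun i => Metric.isOpen_ball) (fun i => ⟨b i, Metric.mem_ball_self (by norm_num)⟩)
    intro i j hij
    apply Metric.ball_disjoint_ball
    have h1 : ‖b i - b j‖ ^ 2 = 2 := by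
      rw [norm_sub_sq (𝕜 := ℂ), ho.1, ho.1, ho.2 hij]; norm_num
    rw [dist_eq_norm]
    nlinarith [norm_nonneg (b i - b j)]
  have hi : Infinite w := by
    rw [← not_finite_iff_infinite]
    intro hf
    have := Fintype.ofFinite w
    exact hinf (b.toOrthonormalBasis.toBasis.finiteDimensional_of_finite)
  obtain ⟨f⟩ := nonempty_equiv_of_countable (α := ℕ) (β := w)
  have ho' : Orthonormal ℂ (b ∘ f) := ho.comp f f.injective
  refine ⟨HilbertBasis.mk ho' ?_⟩
  rw [f.surjective.range_comp, b.dense_span]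

lemma exists_shift_s8 [CompleteSpace H] (b : HilbertBasis ℕ ℂ H) (n : ℕ) :
    ∃ S : H →L[ℂ] H, (∀ x, ‖S x‖ = ‖x‖) ∧ (∀ x, ∀ j ≤ n, inner ℂ (b j) (S x) = (0 : ℂ)) ∧
      (∀ x k, (inner ℂ (b (k + n + 1)) (S x) : ℂ) = inner ℂ (b k) x) := by
  have hv : Orthonormal ℂ (fun k => b (k + n + 1)) :=
    b.orthonormal.comp (fun k => k + n + 1) (fun i j h => by simpa using h)
  let S := hv.orthogonalFamily.linearIsometry.comp b.repr.toLinearIsometry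
  have hS : ∀ x, HasSum (fun k => b.repr x k • b (k + n + 1)) (S x) := fun x =>
    hv.orthogonalFamily.hasSum_linearIsometry (b.repr x)
  have hin : ∀ x j, HasSum (fun k => b.repr x k * inner ℂ (b j) (b (k + n + 1))) (inner ℂ (b j) (S x)) := by
    intro x j
    have := (innerSL ℂ (b j)).hasSum (hS x)
    simpa [inner_smul_right] using this
  refine ⟨S.toContinuousLinearMap, fun x => S.norm_map x, ?_, ?_⟩
  · intro x j hj
    refine (hin x j).unique ?_
    convert hasSum_zero using 2 with k
    rw [b.orthonormal.2 (by omega)]; simp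
  · intro x k
    refine (hin x (k + n + 1)).unique ?_
    convert hasSum_single (f := fun i => b.repr x i * inner ℂ (b (k + n + 1)) (b (i + n + 1))) k ?_ using 1
    · rw [inner_self_eq_norm_sq_to_K, b.orthonormal.1, b.repr_apply_apply]; simp
    · intro i hi
      rw [b.orthonormal.2 (by omega)]; simp

abbrev Iso' (H : Type*) [NormedAddCommGroup H] [InnerProductSpace ℂ H] :=
  {u : H →L[ℂ] H // ∀ h : H, ‖u h‖ = ‖h‖}

lemma iso_inner (u : Iso' H) (x y : H) : (inner ℂ (u.1 x) (u.1 y) : ℂ) = inner ℂ x y :=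
  (LinearIsometry.mk u.1.toLinearMap u.2).inner_map_map x y

lemma shift_ne (b : HilbertBasis ℕ ℂ H) {n : ℕ} {S : H →L[ℂ] H}
    (h0 : ∀ x, ∀ j ≤ n, inner ℂ (b j) (S x) = (0 : ℂ))
    (h1 : ∀ x k, (inner ℂ (b (k + n + 1)) (S x) : ℂ) = inner ℂ (b k) x) {x : H} (hx : ‖x‖ = 1) :
    x + S x ≠ 0 := by
  intro h
  have hk : ∀ k, (inner ℂ (b k) x : ℂ) + inner ℂ (b k) (S x) = 0 := fun k => by
    rw [← inner_add_right, h, inner_zero_right]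
  have hz : ∀ k, (inner ℂ (b k) x : ℂ) = 0 := by
    intro k
    induction k using Nat.strong_induction_on with
    | _ k ih =>
      have := hk k
      rcases le_or_gt k n with hkn | hkn
      · rwa [h0 x k hkn, add_zero] at this
      · obtain ⟨m, rfl⟩ : ∃ m, k = m + n + 1 := ⟨k - n - 1, by omega⟩
        rwa [h1, ih m (by omega), add_zero] at this
  have : b.repr x = 0 := by
    ext k
    rw [b.repr_apply_apply, hz k]; rfl
  have hx0 : x = 0 := by simpa using this
  simp [hx0] at hx

set_option maxHeartbeats 400000 in
/-- Existence of the single stage. -/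
lemma exists_stage [CompleteSpace H] (b : HilbertBasis ℕ ℂ H) (n : ℕ) :
    ∃ G : Iso' H → ℝ → Iso' H,
      (∀ u r, r ≤ 0 → G u r = u) ∧
      (∀ u r, 1 ≤ r → (G u r).1 (b n) = b n) ∧
      (∀ u r, ∀ k < n, (∀ j < n, u.1 (b j) = b j) → (G u r).1 (b k) = b k) ∧
      (∀ (Y : Type u) [TopologicalSpace Y] (f : Y → Iso' H) (r : Y → ℝ), Continuous r →
        Continuous (fun a => (f a).1) → Continuous (fun a => (G (f a) (r a)).1)) ∧
      (∀ (Y : Type u) [TopologicalSpace Y] (f : Y → Iso' H) (r : Y → ℝ), Continuous r →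
        (∀ h, Continuous (fun a => (f a).1 h)) →
        ∀ h, Continuous (fun a => (G (f a) (r a)).1 h)) := by
  obtain ⟨S, hS, h0, h1⟩ := exists_shift_s8 b n
  have hb : ∀ k, ‖b k‖ = 1 := b.orthonormal.1
  have hx : ∀ u : Iso' H, ‖u.1 (b n)‖ = 1 := fun u => by rw [u.2, hb]
  have hy : ∀ u : Iso' H, ‖S (u.1 (b n))‖ = 1 := fun u => by rw [hS, hx]
  have h : ∀ u : Iso' H, u.1 (b n) + S (u.1 (b n)) ≠ 0 := fun u => shift_ne b h0 h1 (hx u)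
  have h' : ∀ u : Iso' H, S (u.1 (b n)) + b n ≠ 0 := fun u hu => by
    have : (inner ℂ (b n) (S (u.1 (b n)) + b n) : ℂ) = 1 := by
      rw [inner_add_right, h0 _ n le_rfl, inner_self_eq_norm_sq_to_K, hb]; simp
    rw [hu] at this
    simp at this
  have hcont : ∀ (Y : Type u) [TopologicalSpace Y] (f : Y → Iso' H) (r : Y → ℝ), Continuous r →
      Continuous (fun a => (f a).1 (b n)) →
      Continuous (fun a => mov ((f a).1 (b n)) (S ((f a).1 (b n))) (b n) (r a)) := by
    intro Y _ f r hr hf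
    exact mov_cont hf (S.continuous.comp hf) hr (fun a => hx _) (fun a => hy _) (hb n)
      (fun a => h _) (fun a => h' _)
  refine ⟨fun u r => ⟨(mov (u.1 (b n)) (S (u.1 (b n))) (b n) r).comp u.1, fun z => ?_⟩,
    ?_, ?_, ?_, ?_, ?_⟩
  · rw [ContinuousLinearMap.comp_apply, mov_norm (hx u) (hy u) (hb n) (h u) (h' u), u.2]
  · intro u r hr
    apply Subtype.ext
    change (mov (u.1 (b n)) (S (u.1 (b n))) (b n) r).comp u.1 = u.1
    rw [mov_zero (hx u) (hy u) hr, ContinuousLinearMap.id_comp]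
  · intro u r hr
    change mov (u.1 (b n)) (S (u.1 (b n))) (b n) r (u.1 (b n)) = b n
    exact mov_one (hx u) (hy u) (hb n) (h u) (h' u) hr
  · intro u r k hk hu
    have hbk : (inner ℂ (b n) (b k) : ℂ) = 0 := b.orthonormal.2 (by omega)
    change mov (u.1 (b n)) (S (u.1 (b n))) (b n) r (u.1 (b k)) = b k
    rw [hu k hk]
    refine mov_perp ?_ ?_ hbk r
    · have h3 := iso_inner u (b n) (b k)
      rw [hu k hk, hbk] at h3
      exact h3
    · rw [← inner_conj_symm, h0 _ k hk.le]; simp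
  · intro Y _ f r hr hf
    change Continuous fun a =>
      (mov ((f a).1 (b n)) (S ((f a).1 (b n))) (b n) (r a)).comp (f a).1
    exact (hcont Y f r hr (hf.clm_apply continuous_const)).clm_comp hf
  · intro Y _ f r hr hf z
    change Continuous fun a =>
      mov ((f a).1 (b n)) (S ((f a).1 (b n))) (b n) (r a) ((f a).1 z)
    exact (hcont Y f r hr (hf _)).clm_apply (hf z)

lemma sot_tendsto {Y : Type*} (l : Filter Y) (f : Y → Iso' H) (v : Iso' H)
    (hf : ∀ h, Filter.Tendsto (fun a => (f a).1 h) l (𝓝 (v.1 h))) :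
    Filter.Tendsto f l (@nhds _ (isomSOT H) v) := by
  unfold isomSOT
  rw [nhds_induced, Filter.tendsto_comap_iff, tendsto_pi_nhds]
  exact hf

/-- Breakpoints. -/
noncomputable def brk (n : ℕ) : ℝ := 1 - 1 / ((n : ℝ) + 1)

lemma brk_lt (n : ℕ) : brk n < 1 := by
  unfold brk
  have : 0 < 1 / ((n : ℝ) + 1) := by positivity
  linarith

lemma brk_zero : brk 0 = 0 := by simp [brk]

lemma brk_lt_succ (n : ℕ) : brk n < brk (n + 1) := by
  unfold brk
  have : 1 / (((n + 1 : ℕ) : ℝ) + 1) < 1 / ((n : ℝ) + 1) := by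
    apply one_div_lt_one_div_of_lt (by positivity)
    push_cast; linarith
  linarith

lemma brk_mono : Monotone brk := monotone_nat_of_le_succ fun n => (brk_lt_succ n).le

lemma exists_brk {t : ℝ} (ht : t < 1) : ∃ n, t < brk n := by
  obtain ⟨n, hn⟩ := exists_nat_one_div_lt (sub_pos.2 ht)
  exact ⟨n, by unfold brk; linarith⟩

noncomputable def par (n : ℕ) (t : ℝ) : ℝ := (t - brk n) / (brk (n + 1) - brk n)

lemma par_cont (n : ℕ) : Continuous (par n) := by unfold par; fun_prop

lemma par_le {n : ℕ} {t : ℝ} (h : t ≤ brk n) : par n t ≤ 0 :=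
  div_nonpos_of_nonpos_of_nonneg (by linarith) (by linarith [brk_lt_succ n])

lemma par_ge {n : ℕ} {t : ℝ} (h : brk (n + 1) ≤ t) : 1 ≤ par n t := by
  unfold par
  rw [le_div_iff₀ (by linarith [brk_lt_succ n])]
  linarith

/-- Finite concatenations. -/
noncomputable def phi (G : ℕ → Iso' H → ℝ → Iso' H) : ℕ → Iso' H → ℝ → Iso' H
  | 0, u, _ => u
  | n + 1, u, t => G n (phi G n u t) (par n t)

open Classical in
noncomputable def bigF (G : ℕ → Iso' H → ℝ → Iso' H) (u : Iso' H) (t : ℝ) : Iso' H :=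
  if h : t < 1 then phi G (Nat.find (exists_brk h)) u t
  else ⟨ContinuousLinearMap.id ℂ H, fun _ => rfl⟩

end main

/-- The space of linear isometric embeddings `H → H` with the strong operator topology
is contractible, by a homotopy which is moreover norm-continuous except at the last
moment. -/
theorem stmt8 {H : Type*} [NormedAddCommGroup H] [InnerProductSpace ℂ H]
    [CompleteSpace H] [TopologicalSpace.SeparableSpace H]
    (hinf : ¬FiniteDimensional ℂ H) :
    ∃ F : {u : H →L[ℂ] H // ∀ h : H, ‖u h‖ = ‖h‖} → ℝ →
        {u : H →L[ℂ] H // ∀ h : H, ‖u h‖ = ‖h‖},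
      (∀ u, F u 0 = u) ∧ (∀ u, (F u 1).1 = ContinuousLinearMap.id ℂ H) ∧
      @ContinuousOn ({u : H →L[ℂ] H // ∀ h : H, ‖u h‖ = ‖h‖} × ℝ)
        {u : H →L[ℂ] H // ∀ h : H, ‖u h‖ = ‖h‖}
        (@instTopologicalSpaceProd _ _ (isomSOT H) inferInstance) (isomSOT H)
        (fun p => F p.1 p.2) (univ ×ˢ Icc (0 : ℝ) 1) ∧
      ContinuousOn (fun p : {u : H →L[ℂ] H // ∀ h : H, ‖u h‖ = ‖h‖} × ℝ => F p.1 p.2)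
        (univ ×ˢ Ico (0 : ℝ) 1) := by
  obtain ⟨b⟩ := exists_onb hinf
  choose G hG0 hG1 hGp hGn hGs using exists_stage b
  -- stability
  have stab : ∀ u t n m, n ≤ m → t ≤ brk n → phi G m u t = phi G n u t := by
    intro u t n m hnm ht
    induction m, hnm using Nat.le_induction with
    | base => rfl
    | succ m hm ih =>
      rw [← ih]
      exact hG0 _ _ _ (par_le (ht.trans (brk_mono hm)))
  have bigF_eq : ∀ u t n, t < brk n → bigF G u t = phi G n u t := by
    intro u t n ht
    have h1 : t < 1 := ht.trans (brk_lt n)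
    classical
    rw [bigF, dif_pos h1]
    refine (stab u t _ n ?_ ?_).symm
    · exact Nat.find_min' _ ht
    · exact (Nat.find_spec (exists_brk h1)).le
  have fix : ∀ m u t k, k < m → brk m ≤ t → (phi G m u t).1 (b k) = b k := by
    intro m
    induction m with
    | zero => intro u t k hk; omega
    | succ m ih =>
      intro u t k hk ht
      have hm : brk m ≤ t := (brk_lt_succ m).le.trans ht
      rcases Nat.lt_succ_iff_lt_or_eq.1 hk with hk | rfl
      · exact hGp m _ _ k hk fun j hj => ih u t j hj hm
      · exact hG1 k _ _ (par_ge ht)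
  have fixF : ∀ n u t k, k < n → brk n ≤ t → (bigF G u t).1 (b k) = b k := by
    intro n u t k hk ht
    classical
    by_cases h1 : t < 1
    · rw [bigF, dif_pos h1]
      have hs := Nat.find_spec (exists_brk h1)
      have hmin := fun j => Nat.find_min (exists_brk h1) (m := j)
      generalize Nat.find (exists_brk h1) = m at hs hmin
      have hnm : n < m := by
        by_contra hcon
        exact absurd (brk_mono (not_lt.1 hcon)) (by linarith)
      obtain ⟨m, rfl⟩ : ∃ m', m = m' + 1 := ⟨m - 1, by omega⟩
      have hm : brk m ≤ t := not_lt.1 (hmin m (by omega))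
      exact hGp m _ _ k (by omega) fun j hj => fix m u t j hj hm
    · rw [bigF, dif_neg h1]
      rfl
  have fixS : ∀ h ∈ Submodule.span ℂ (Set.range b), ∃ n, ∀ u t, brk n ≤ t →
      (bigF G u t).1 h = h := by
    intro h hh
    induction hh using Submodule.span_induction with
    | mem x hx =>
      obtain ⟨k, rfl⟩ := hx
      exact ⟨k + 1, fun u t ht => fixF (k + 1) u t k (by omega) ht⟩
    | zero => exact ⟨0, fun u t _ => map_zero _⟩
    | add x y _ _ hx hy =>
      obtain ⟨n, hn⟩ := hx
      obtain ⟨m, hm⟩ := hy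
      refine ⟨max n m, fun u t ht => ?_⟩
      rw [map_add, hn u t ((brk_mono (le_max_left _ _)).trans ht),
        hm u t ((brk_mono (le_max_right _ _)).trans ht)]
    | smul c x _ hx =>
      obtain ⟨n, hn⟩ := hx
      exact ⟨n, fun u t ht => by rw [map_smul, hn u t ht]⟩
  have unif : ∀ h : H, ∀ ε > 0, ∃ n, ∀ u t, brk n ≤ t → ‖(bigF G u t).1 h - h‖ < ε := by
    intro h ε hε
    have hd : h ∈ closure ((Submodule.span ℂ (Set.range b) : Submodule ℂ H) : Set H) := by
      rw [← Submodule.topologicalClosure_coe, b.dense_span]; trivial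
    obtain ⟨g, hg, hgh⟩ := Metric.mem_closure_iff.1 hd (ε / 2) (by linarith)
    obtain ⟨n, hn⟩ := fixS g hg
    refine ⟨n, fun u t ht => ?_⟩
    have e1 : (bigF G u t).1 h - h = (bigF G u t).1 (h - g) - (h - g) := by
      rw [map_sub, hn u t ht]; abel
    rw [dist_eq_norm] at hgh
    calc _ = ‖(bigF G u t).1 (h - g) - (h - g)‖ := by rw [e1]
      _ ≤ ‖(bigF G u t).1 (h - g)‖ + ‖h - g‖ := norm_sub_le _ _
      _ = ‖h - g‖ + ‖h - g‖ := by rw [(bigF G u t).2]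
      _ < ε := by linarith
  have F0 : ∀ u, bigF G u 0 = u := by
    intro u
    rw [bigF_eq u 0 1 (by rw [← brk_zero]; exact brk_lt_succ 0)]
    exact hG0 _ _ _ (par_le brk_zero.ge)
  have F1 : ∀ u, (bigF G u 1).1 = ContinuousLinearMap.id ℂ H := by
    intro u
    rw [bigF, dif_neg (lt_irrefl _)]
  refine ⟨bigF G, F0, F1, ?_, ?_⟩
  · let τ : TopologicalSpace (Iso' H) := isomSOT H
    have hev : ∀ h, Continuous fun u : Iso' H => u.1 h := fun h =>
      (continuous_apply h).comp continuous_induced_dom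
    have hphi : ∀ n h, Continuous fun p : Iso' H × ℝ => (phi G n p.1 p.2).1 h := by
      intro n
      induction n with
      | zero => exact fun h => (hev h).comp continuous_fst
      | succ n ih =>
        exact hGs n (Iso' H × ℝ) (fun p => phi G n p.1 p.2) (fun p => par n p.2)
          ((par_cont n).comp continuous_snd) ih
    rintro ⟨u, t⟩ ⟨-, ht⟩
    apply ContinuousAt.continuousWithinAt
    refine sot_tendsto _ _ _ ?_
    intro h
    change Filter.Tendsto (fun p : Iso' H × ℝ => (bigF G p.1 p.2).1 h) (𝓝 (u, t))
      (𝓝 ((bigF G u t).1 h))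
    rcases lt_or_eq_of_le ht.2 with h1 | h1
    · obtain ⟨n, hn⟩ := exists_brk h1
      have hev : ∀ᶠ p : Iso' H × ℝ in 𝓝 (u, t), (phi G n p.1 p.2).1 h = (bigF G p.1 p.2).1 h := by
        filter_upwards [continuous_snd.continuousAt.eventually (Iio_mem_nhds hn)] with p hp
        rw [bigF_eq p.1 p.2 n hp]
      rw [bigF_eq u t n hn]
      exact ((hphi n h).tendsto (u, t)).congr' hev
    · simp only at h1
      subst h1
      rw [F1, ContinuousLinearMap.id_apply, Metric.tendsto_nhds]
      intro ε hε
      obtain ⟨n, hn⟩ := unif h ε hε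
      filter_upwards [continuous_snd.continuousAt.eventually (Ioi_mem_nhds (brk_lt n))] with p hp
      rw [dist_eq_norm]
      exact hn _ _ (le_of_lt hp)
  · have hphi : ∀ n, Continuous fun p : Iso' H × ℝ => (phi G n p.1 p.2).1 := by
      intro n
      induction n with
      | zero => exact continuous_subtype_val.comp continuous_fst
      | succ n ih =>
        exact hGn n (Iso' H × ℝ) (fun p => phi G n p.1 p.2) (fun p => par n p.2)
          ((par_cont n).comp continuous_snd) ih
    rintro ⟨u, t⟩ ⟨-, ht⟩
    apply ContinuousAt.continuousWithinAt
    obtain ⟨n, hn⟩ := exists_brk ht.2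
    have hev : (fun p : Iso' H × ℝ => phi G n p.1 p.2) =ᶠ[𝓝 (u, t)]
        fun p => bigF G p.1 p.2 := by
      filter_upwards [continuous_snd.continuousAt.eventually (Iio_mem_nhds hn)] with p hp
      rw [bigF_eq p.1 p.2 n hp]
    exact ((hphi n).subtype_mk fun p => (phi G n p.1 p.2).2).continuousAt.congr hev
end
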